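/- Let ℓ̄ be the multiplicity of f in the minimal polynomial of A and let B be a Jordan–Krylov basis of ker f(A)^ℓ̄ with respect to A. Then Σ_{b∈B} P_A(b) = {v ∈ ℂ^n : f(A)^ℓ̄ v = 0}; that is, the sum of the subspaces P_A(b) over b ∈ B equals the extension of ker f(A)^ℓ̄ to scalars in ℂ (i.e. ℂ ⊗_K ker f(A)^ℓ̄ viewed inside ℂ^n). -/

import Mathlib

open Polynomial Matrix
set_option synthInstance.maxHeartbeats 1000000
set_option maxHeartbeats 1000000

/-- The complex matrix obtained from a matrix over a subfield `K` of `ℂ`. -/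
noncomputable def matC (K : Subfield ℂ) {n : ℕ} (A : Matrix (Fin n) (Fin n) K) :
    Matrix (Fin n) (Fin n) ℂ :=
  A.map (fun x => (x : ℂ))

/-- The complex vector obtained from a vector over a subfield `K` of `ℂ`. -/
noncomputable def vecC (K : Subfield ℂ) {n : ℕ} (w : Fin n → K) : Fin n → ℂ :=
  fun i => (w i : ℂ)

/-- For a root `α` of `f`, the quotient `g_α(x) = f(x)/(x - α)` in `ℂ[x]`,
i.e. the paper's `ψ_f(x, α)`. -/
noncomputable def galpha (K : Subfield ℂ) (f : Polynomial K) (α : ℂ) : Polynomial ℂ :=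
  (f.map K.subtype) / (X - C α)

/-- The generalized eigenvector `p⁽ᵏ⁾(α, u) = g_α(A)^k · f(A)^(ℓ-k) · u`, where
`ℓ = rank_f u`. -/
noncomputable def pvec (K : Subfield ℂ) {n : ℕ} (A : Matrix (Fin n) (Fin n) K)
    (f : Polynomial K) (α : ℂ) (ℓ k : ℕ) (u : Fin n → K) : Fin n → ℂ :=
  ((Polynomial.aeval (matC K A) (galpha K f α)) ^ k *
    (Polynomial.aeval (matC K A) (f.map K.subtype)) ^ (ℓ - k)).mulVec (vecC K u)

/-- `rank_f u`: the least `ℓ` with `f(A)^ℓ u = 0`. -/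
noncomputable def rankf (K : Subfield ℂ) {n : ℕ} (A : Matrix (Fin n) (Fin n) K)
    (f : Polynomial K) (u : Fin n → K) : ℕ :=
  sInf {ℓ : ℕ | ((Polynomial.aeval A f) ^ ℓ).mulVec u = 0}

/-- The subspace `P_A(α, u) = Span_ℂ {p⁽ᵏ⁾(α, u) : 1 ≤ k ≤ rank_f u}` of `ℂ^n`. -/
noncomputable def Pspace (K : Subfield ℂ) {n : ℕ} (A : Matrix (Fin n) (Fin n) K)
    (f : Polynomial K) (α : ℂ) (u : Fin n → K) : Submodule ℂ (Fin n → ℂ) :=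
  Submodule.span ℂ
    ((fun k => pvec K A f α (rankf K A f u) k u) '' Set.Icc 1 (rankf K A f u))

/-- The Krylov subspace `L_A(u) = Span_K {A^k u : k ≥ 0}`. -/
noncomputable def krylov (K : Subfield ℂ) {n : ℕ} (A : Matrix (Fin n) (Fin n) K)
    (u : Fin n → K) : Submodule K (Fin n → K) :=
  Submodule.span K (Set.range fun k : ℕ => (A ^ k).mulVec u)

/-- `B` is a Jordan–Krylov basis of `ker f(A)^ℓ̄` with respect to `A`:
it is a finite subset of `ker f(A)^ℓ̄`, the family of Krylov subspaces of its elements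
is independent, and their sum is `ker f(A)^ℓ̄`. -/
def IsJordanKrylovBasis (K : Subfield ℂ) {n : ℕ} (A : Matrix (Fin n) (Fin n) K)
    (f : Polynomial K) (lbar : ℕ) (B : Finset (Fin n → K)) : Prop :=
  (∀ b ∈ B, ((Polynomial.aeval A f) ^ lbar).mulVec b = 0) ∧
  iSupIndep (fun b : B => krylov K A b.val) ∧
  (⨆ b ∈ B, krylov K A b) = LinearMap.ker (((Polynomial.aeval A f) ^ lbar).mulVecLin)

/-- `P_A(u) = Σ_α P_A(α, u)`, the sum over the roots `α` of `f` in `ℂ`. -/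
noncomputable def PspaceTotal (K : Subfield ℂ) {n : ℕ} (A : Matrix (Fin n) (Fin n) K)
    (f : Polynomial K) (u : Fin n → K) : Submodule ℂ (Fin n → ℂ) :=
  ⨆ (α : ℂ) (_ : (f.map K.subtype).IsRoot α), Pspace K A f α u

section

variable {K : Subfield ℂ} {n : ℕ}

/-- Coordinatewise inclusion `K^n → ℂ^n` as a `K`-linear map. -/
noncomputable def vecCLin (K : Subfield ℂ) (n : ℕ) : (Fin n → K) →ₗ[K] (Fin n → ℂ) where
  toFun := vecC K
  map_add' x y := by ext i; simp [vecC]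
  map_smul' c x := by ext i; simp [vecC, Subfield.smul_def]

theorem matC_mulVec_vecC (A : Matrix (Fin n) (Fin n) K) (w : Fin n → K) :
    (matC K A).mulVec (vecC K w) = vecC K (A.mulVec w) := by
  ext i
  simp [matC, vecC, Matrix.mulVec, dotProduct]

theorem matC_pow (A : Matrix (Fin n) (Fin n) K) (k : ℕ) :
    matC K (A ^ k) = matC K A ^ k :=
  map_pow K.subtype.mapMatrix A k

theorem aeval_matC_map (A : Matrix (Fin n) (Fin n) K) (p : Polynomial K) :
    aeval (matC K A) (p.map K.subtype) = matC K (aeval A p) := by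
  refine (Polynomial.map_aeval_eq_aeval_map (φ := K.subtype) (ψ := K.subtype.mapMatrix)
    ?_ p A).symm
  ext c i j
  by_cases h : i = j <;> simp [Matrix.algebraMap_matrix_apply, h]

/-- The kernel of a matrix over `K` spans the kernel of the same matrix over `ℂ`. -/
theorem ker_matC_le_of_vecC_mem (N : Matrix (Fin n) (Fin n) K)
    (S : Submodule ℂ (Fin n → ℂ)) (hS : ∀ w, N.mulVec w = 0 → vecC K w ∈ S) :
    LinearMap.ker (matC K N).mulVecLin ≤ S := by
  intro v hv
  rw [LinearMap.mem_ker, Matrix.mulVecLin_apply] at hv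
  let e := Module.Basis.ofVectorSpace K ℂ
  let w := fun j i => e.repr (v i) j
  have hw (j) : N.mulVec (w j) = 0 := by
    ext i
    have h := congrArg (fun z => ((e.repr (z i) j : K) : ℂ)) hv
    have h2 : ∀ i k, ((N i k : K) : ℂ) * v k = N i k • v k := fun _ _ => rfl
    simpa [matC, Matrix.mulVec, dotProduct, h2, w] using h
  have hsum : v = ∑ j ∈ Finset.univ.biUnion (fun i => (e.repr (v i)).support),
      e j • vecC K (w j) := by
    ext i
    conv_lhs => rw [← e.linearCombination_repr (v i), Finsupp.linearCombination_apply,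
      Finsupp.sum_of_support_subset _
        (Finset.subset_biUnion_of_mem (fun i => (e.repr (v i)).support) (Finset.mem_univ i))
        _ (by simp)]
    simp [vecC, w, Subfield.smul_def, mul_comm]
  rw [hsum]
  exact S.sum_mem fun j _ => S.smul_mem _ (hS _ (hw j))

theorem X_sub_C_mul_galpha {f : Polynomial K} {α : ℂ} (hα : (f.map K.subtype).IsRoot α) :
    (X - C α) * galpha K f α = f.map K.subtype :=
  mul_div_eq_iff_isRoot.mpr hα

theorem eval_galpha_ne_zero {f : Polynomial K} (hirr : Irreducible f) {α : ℂ}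
    (hα : (f.map K.subtype).IsRoot α) : (galpha K f α).eval α ≠ 0 := by
  have hd := hirr.separable.map (f := K.subtype)
  have h := hd.eval₂_derivative_ne_zero (RingHom.id ℂ) (x := α) (by simpa using hα)
  rw [← X_sub_C_mul_galpha hα] at h
  simpa using h

/-- For a separable polynomial the powers `g_α^ℓ` have no common root, so they generate
the unit ideal. -/
theorem eq_top_of_galpha_pow_mem {f : Polynomial K} (hirr : Irreducible f) (l : ℕ)
    (I : Ideal (Polynomial ℂ))
    (hI : ∀ α, (f.map K.subtype).IsRoot α → galpha K f α ^ l ∈ I) : I = ⊤ := by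
  obtain ⟨d, rfl⟩ := (IsPrincipalIdealRing.principal I).principal
  by_contra hne
  have hd : d.degree ≠ 0 := fun h =>
    hne (Ideal.span_singleton_eq_top.mpr (isUnit_iff_degree_eq_zero.mpr h))
  obtain ⟨β, hβ⟩ := IsAlgClosed.exists_root d hd
  have hroot (α) (hα : (f.map K.subtype).IsRoot α) : (galpha K f α).eval β = 0 := by
    have h := (hβ.dvd (Ideal.mem_span_singleton.mp (hI α hα)))
    rw [IsRoot.def, eval_pow] at h
    exact eq_zero_of_pow_eq_zero h
  obtain ⟨α, hα⟩ := IsAlgClosed.exists_root (f.map K.subtype)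
    (by rw [degree_map]; exact (degree_pos_of_irreducible hirr).ne')
  have hβf : (f.map K.subtype).IsRoot β := by
    rw [IsRoot.def, ← X_sub_C_mul_galpha hα, eval_mul, hroot α hα, mul_zero]
  exact eval_galpha_ne_zero hirr hβf (hroot β hβf)

theorem aeval_mulVec_mem (M : Matrix (Fin n) (Fin n) ℂ) (S : Submodule ℂ (Fin n → ℂ))
    (hS : ∀ v ∈ S, M.mulVec v ∈ S) (q : Polynomial ℂ) {v : Fin n → ℂ} (hv : v ∈ S) :
    (aeval M q).mulVec v ∈ S := by
  induction q using Polynomial.induction_on generalizing v with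
  | C a => simpa [Algebra.algebraMap_eq_smul_one, Matrix.smul_mulVec] using S.smul_mem a hv
  | add p q hp hq => simpa [Matrix.add_mulVec] using S.add_mem (hp hv) (hq hv)
  | monomial k a ih =>
    rw [pow_succ, ← mul_assoc, map_mul, aeval_X, ← Matrix.mulVec_mulVec]
    exact ih (hS v hv)

theorem aeval_pow_rankf_mulVec {A : Matrix (Fin n) (Fin n) K} {f : Polynomial K} {l : ℕ}
    {u : Fin n → K} (hu : ((aeval A f) ^ l).mulVec u = 0) :
    ((aeval (matC K A) (f.map K.subtype)) ^ rankf K A f u).mulVec (vecC K u) = 0 := by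
  have h : ((aeval A f) ^ rankf K A f u).mulVec u = 0 :=
    Nat.sInf_mem (s := {l : ℕ | ((aeval A f) ^ l).mulVec u = 0}) ⟨l, hu⟩
  rw [aeval_matC_map, ← matC_pow, matC_mulVec_vecC, h]
  exact (vecCLin K n).map_zero

theorem mulVec_pvec_succ {A : Matrix (Fin n) (Fin n) K} {f : Polynomial K} {α : ℂ}
    (hα : (f.map K.subtype).IsRoot α) {l k : ℕ} (hk : k + 1 ≤ l) (u : Fin n → K) :
    (matC K A).mulVec (pvec K A f α l (k + 1) u) =
      α • pvec K A f α l (k + 1) u + pvec K A f α l k u := by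
  obtain ⟨m, rfl⟩ := Nat.exists_eq_add_of_le hk
  have hq : X * (galpha K f α ^ (k + 1) * f.map K.subtype ^ m) =
      C α * (galpha K f α ^ (k + 1) * f.map K.subtype ^ m) +
        galpha K f α ^ k * f.map K.subtype ^ (m + 1) := by
    rw [pow_succ (f.map K.subtype) m]
    nth_rewrite 4 [← X_sub_C_mul_galpha hα]
    ring
  have h := congrArg (fun q => (aeval (matC K A) q).mulVec (vecC K u)) hq
  have e1 : k + 1 + m - (k + 1) = m := by omega
  have e2 : k + 1 + m - k = m + 1 := by omega
  simpa [pvec, e1, e2, Matrix.add_mulVec, Algebra.algebraMap_eq_smul_one,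
    Matrix.smul_mulVec, Matrix.mulVec_mulVec] using h

theorem mulVec_mem_Pspace {A : Matrix (Fin n) (Fin n) K} {f : Polynomial K} {α : ℂ}
    (hα : (f.map K.subtype).IsRoot α) {l : ℕ} {u : Fin n → K}
    (hu : ((aeval A f) ^ l).mulVec u = 0) {v : Fin n → ℂ} (hv : v ∈ Pspace K A f α u) :
    (matC K A).mulVec v ∈ Pspace K A f α u := by
  suffices h : Pspace K A f α u ≤ (Pspace K A f α u).comap (matC K A).mulVecLin from h hv
  refine Submodule.span_le.mpr ?_
  rintro _ ⟨k, ⟨hk1, hk2⟩, rfl⟩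
  obtain ⟨k, rfl⟩ := Nat.exists_eq_add_of_le' hk1
  have hmem (j : ℕ) (hj : j ≤ rankf K A f u) :
      pvec K A f α (rankf K A f u) j u ∈ Pspace K A f α u := by
    rcases Nat.eq_zero_or_pos j with rfl | hj0
    · simp [pvec, aeval_pow_rankf_mulVec hu]
    · exact Submodule.subset_span ⟨j, ⟨hj0, hj⟩, rfl⟩
  change (matC K A).mulVec _ ∈ Pspace K A f α u
  rw [mulVec_pvec_succ hα hk2]
  exact add_mem (Submodule.smul_mem _ _ (hmem _ hk2)) (hmem _ (by omega))

theorem mulVec_mem_PspaceTotal {A : Matrix (Fin n) (Fin n) K} {f : Polynomial K}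
    {l : ℕ} {u : Fin n → K} (hu : ((aeval A f) ^ l).mulVec u = 0) {v : Fin n → ℂ}
    (hv : v ∈ PspaceTotal K A f u) : (matC K A).mulVec v ∈ PspaceTotal K A f u := by
  suffices h : PspaceTotal K A f u ≤ (PspaceTotal K A f u).comap (matC K A).mulVecLin from h hv
  refine iSup₂_le fun α hα w hw => ?_
  exact Submodule.mem_iSup_of_mem α (Submodule.mem_iSup_of_mem hα (mulVec_mem_Pspace hα hu hw))

theorem vecC_mem_PspaceTotal {A : Matrix (Fin n) (Fin n) K} {f : Polynomial K}
    (hirr : Irreducible f) {l : ℕ} {u : Fin n → K}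
    (hu : ((aeval A f) ^ l).mulVec u = 0) : vecC K u ∈ PspaceTotal K A f u := by
  let I : Ideal (Polynomial ℂ) :=
    { carrier := {q | (aeval (matC K A) q).mulVec (vecC K u) ∈ PspaceTotal K A f u}
      zero_mem' := by simp
      add_mem' := fun {p q} hp hq => by
        simpa [Matrix.add_mulVec] using add_mem hp hq
      smul_mem' := fun q p hp => by
        have h := aeval_mulVec_mem _ _ (fun _ => mulVec_mem_PspaceTotal hu) q hp
        simpa [Matrix.mulVec_mulVec] using h }
  have hI : I = ⊤ := by
    refine eq_top_of_galpha_pow_mem hirr (rankf K A f u) I fun α hα => ?_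
    change (aeval (matC K A) (galpha K f α ^ rankf K A f u)).mulVec (vecC K u) ∈ PspaceTotal K A f u
    rcases Nat.eq_zero_or_pos (rankf K A f u) with h0 | hpos
    · have h := aeval_pow_rankf_mulVec hu
      rw [h0, pow_zero, Matrix.one_mulVec] at h
      simp [h]
    · refine Submodule.mem_iSup_of_mem α (Submodule.mem_iSup_of_mem hα
        (Submodule.subset_span ⟨rankf K A f u, ⟨hpos, le_rfl⟩, ?_⟩))
      simp [pvec]
  have h1 : (1 : Polynomial ℂ) ∈ I := hI ▸ Submodule.mem_top
  change (aeval (matC K A) 1).mulVec (vecC K u) ∈ PspaceTotal K A f u at h1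
  simpa using h1

theorem krylov_le_comap_PspaceTotal {A : Matrix (Fin n) (Fin n) K} {f : Polynomial K}
    (hirr : Irreducible f) {l : ℕ} {u : Fin n → K} (hu : ((aeval A f) ^ l).mulVec u = 0) :
    krylov K A u ≤ ((PspaceTotal K A f u).restrictScalars K).comap (vecCLin K n) := by
  refine Submodule.span_le.mpr ?_
  rintro _ ⟨k, rfl⟩
  change vecC K ((A ^ k).mulVec u) ∈ PspaceTotal K A f u
  rw [← matC_mulVec_vecC, matC_pow]
  simpa using aeval_mulVec_mem _ _ (fun _ => mulVec_mem_PspaceTotal hu) (X ^ k)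
    (vecC_mem_PspaceTotal hirr hu)

theorem PspaceTotal_le_ker {A : Matrix (Fin n) (Fin n) K} {f : Polynomial K} {l : ℕ}
    {u : Fin n → K} (hu : ((aeval A f) ^ l).mulVec u = 0) :
    PspaceTotal K A f u ≤
      LinearMap.ker ((aeval (matC K A) (f.map K.subtype)) ^ l).mulVecLin := by
  have hu' : ((aeval (matC K A) (f.map K.subtype)) ^ l).mulVec (vecC K u) = 0 := by
    rw [aeval_matC_map, ← matC_pow, matC_mulVec_vecC, hu]
    exact (vecCLin K n).map_zero
  refine iSup₂_le fun α _ => Submodule.span_le.mpr ?_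
  rintro _ ⟨k, -, rfl⟩
  simp only [SetLike.mem_coe, LinearMap.mem_ker, Matrix.mulVecLin_apply, pvec]
  simp only [← map_pow, ← map_mul, Matrix.mulVec_mulVec] at hu' ⊢
  rw [mul_comm, map_mul, ← Matrix.mulVec_mulVec, hu', Matrix.mulVec_zero]

end

theorem stmt8 (K : Subfield ℂ) (n : ℕ) (hn : 1 ≤ n)
    (A : Matrix (Fin n) (Fin n) K) (f : Polynomial K)
    (hmonic : f.Monic) (hirr : Irreducible f) (hdvd : f ∣ A.charpoly)
    (lbar : ℕ) (hl1 : f ^ lbar ∣ minpoly K A) (hl2 : ¬ f ^ (lbar + 1) ∣ minpoly K A)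
    (B : Finset (Fin n → K)) (hB : IsJordanKrylovBasis K A f lbar B) :
    (⨆ b ∈ B, PspaceTotal K A f b) =
      LinearMap.ker
        (((Polynomial.aeval (matC K A) (f.map K.subtype)) ^ lbar).mulVecLin) := by
  obtain ⟨hker, -, hsup⟩ := hB
  refine le_antisymm (iSup₂_le fun b hb => PspaceTotal_le_ker (hker b hb)) ?_
  rw [aeval_matC_map, ← matC_pow]
  refine ker_matC_le_of_vecC_mem _ _ fun w hw => ?_
  have hle : (⨆ b ∈ B, krylov K A b) ≤
      ((⨆ b ∈ B, PspaceTotal K A f b).restrictScalars K).comap (vecCLin K n) :=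
    iSup₂_le fun b hb x hx =>
      le_iSup₂_of_le (f := fun b (_ : b ∈ B) => PspaceTotal K A f b) b hb le_rfl
        (krylov_le_comap_PspaceTotal hirr (hker b hb) hx)
  rw [hsup] at hle
  exact hle hw
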